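/- Let k be a field of characteristic 2 and V a finite dimensional k-vector space. The dimension of the image of the map Γ^d(V) → Γ^{d-2}(V) ⊗ V^{(1)} (induced by the comultiplication of Γ(V) followed by the Verschiebung Γ²(V) → V^{(1)}) equals dim Γ^d(V) − dim Λ^d(V); equivalently, the kernel of this map is exactly the image of the canonical inclusion Λ^d(V) ↪ Γ^d(V). -/

import Mathlib

set_option synthInstance.maxHeartbeats 800000
set_option maxHeartbeats 1600000

open scoped TensorProduct

variable (k : Type*) [Field k] (V : Type*) [AddCommGroup V] [Module k V]

/-- The action of a permutation `σ` on the `d`-th tensor power of `V`. -/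
noncomputable def permTensor (d : ℕ) (σ : Equiv.Perm (Fin d)) :
    (⨂[k] (_ : Fin d), V) →ₗ[k] (⨂[k] (_ : Fin d), V) :=
  (PiTensorProduct.reindex k (fun _ : Fin d => V) σ).toLinearMap

/-- `Γ^d(V) = (V^{⊗d})^{Σ_d}`, the submodule of symmetric `d`-tensors of `V`. -/
noncomputable def symTensors (d : ℕ) : Submodule k (⨂[k] (_ : Fin d), V) :=
  ⨅ σ : Equiv.Perm (Fin d), LinearMap.ker (permTensor k V d σ - LinearMap.id)

/-- The deconcatenation `V^{⊗d} ≅ V^{⊗(d-2)} ⊗ V^{⊗2}` (the identity map, regrouping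
factors). -/
noncomputable def splitEquiv (d : ℕ) (hd : 2 ≤ d) :
    (⨂[k] (_ : Fin d), V) ≃ₗ[k]
      ((⨂[k] (_ : Fin (d - 2)), V) ⊗[k] (⨂[k] (_ : Fin 2), V)) :=
  (PiTensorProduct.reindex k (fun _ : Fin d => V)
      ((finCongr (by omega : d = d - 2 + 2)).trans finSumFinEquiv.symm)).trans
    (PiTensorProduct.tmulEquiv k V).symm

/-- The submodule of `Γ²(V)` spanned by the symmetrized tensors `x⊗y + y⊗x`; in
characteristic 2 this is the image of `Λ²(V) ↪ Γ²(V)`, and the Verschiebung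
`Γ²(V) → V^{(1)}` is exactly the quotient by this submodule (it sends `x⊗x ↦ x` and kills
`x⊗y + y⊗x`). -/
noncomputable def symmetrizedSub : Submodule k (symTensors k V 2) :=
  Submodule.comap (symTensors k V 2).subtype
    (Submodule.span k {u : ⨂[k] (_ : Fin 2), V | ∃ x y : V,
      u = PiTensorProduct.tprod k ![x, y] + PiTensorProduct.tprod k ![y, x]})

/-- The image of the canonical inclusion `Λ^d(V) ↪ Γ^d(V)` (in characteristic 2):
the span of the full symmetrizations `Σ_{σ ∈ Σ_d} x_{σ(1)}⊗⋯⊗x_{σ(d)}`. -/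
noncomputable def antisymImage (d : ℕ) : Submodule k (symTensors k V d) :=
  Submodule.comap (symTensors k V d).subtype
    (Submodule.span k {u : ⨂[k] (_ : Fin d), V | ∃ x : Fin d → V,
      u = ∑ σ : Equiv.Perm (Fin d), PiTensorProduct.tprod k (fun i => x (σ i))})

noncomputable instance instACGTarget (d : ℕ) :
    AddCommGroup ((↥(symTensors k V (d - 2))) ⊗[k]
      ((↥(symTensors k V 2)) ⧸ symmetrizedSub k V)) :=
  inferInstance

noncomputable instance instModTarget (d : ℕ) :
    Module k ((↥(symTensors k V (d - 2))) ⊗[k]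
      ((↥(symTensors k V 2)) ⧸ symmetrizedSub k V)) :=
  inferInstance

section Helpers

open Module

variable {k V} {n : ℕ} (b : Basis (Fin n) k V)

/-- Coordinate functional on the tensor power. -/
noncomputable def tcoord {d : ℕ} (f : Fin d → Fin n) : (⨂[k] (_ : Fin d), V) →ₗ[k] k :=
  (Basis.piTensorProduct (fun _ : Fin d => b)).coord f

theorem tcoord_tprod {d : ℕ} (f : Fin d → Fin n) (x : Fin d → V) :
    tcoord b f (PiTensorProduct.tprod k x) = ∏ i, b.repr (x i) (f i) := by
  simp [tcoord]

theorem tcoord_ext {d : ℕ} {s t : ⨂[k] (_ : Fin d), V}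
    (h : ∀ f, tcoord b f s = tcoord b f t) : s = t :=
  (Basis.piTensorProduct (fun _ : Fin d => b)).ext_elem h

theorem tcoord_perm {d : ℕ} (f : Fin d → Fin n) (σ : Equiv.Perm (Fin d))
    (t : ⨂[k] (_ : Fin d), V) :
    tcoord b f (permTensor k V d σ t) = tcoord b (f ∘ σ) t := by
  have : (tcoord b f) ∘ₗ (permTensor k V d σ) = tcoord b (f ∘ σ) := by
    apply PiTensorProduct.ext
    ext x
    simp only [LinearMap.compMultilinearMap_apply, LinearMap.comp_apply, permTensor,
      LinearEquiv.coe_coe, PiTensorProduct.reindex_tprod, tcoord_tprod]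
    rw [← Equiv.prod_comp σ]
    exact Finset.prod_congr rfl fun i _ => by rw [Equiv.symm_apply_apply]; rfl
  exact LinearMap.congr_fun this t

theorem mem_sym {d : ℕ} (t : ⨂[k] (_ : Fin d), V) :
    t ∈ symTensors k V d ↔ ∀ σ : Equiv.Perm (Fin d), permTensor k V d σ t = t := by
  simp only [symTensors, Submodule.mem_iInf, LinearMap.mem_ker, LinearMap.sub_apply,
    LinearMap.id_apply, sub_eq_zero]

theorem mem_sym_iff {d : ℕ} (t : ⨂[k] (_ : Fin d), V) :
    t ∈ symTensors k V d ↔ ∀ (σ : Equiv.Perm (Fin d)) f, tcoord b (f ∘ σ) t = tcoord b f t := by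
  simp only [symTensors, Submodule.mem_iInf, LinearMap.mem_ker, LinearMap.sub_apply,
    LinearMap.id_apply, sub_eq_zero]
  constructor
  · intro h σ f
    rw [← tcoord_perm, h]
  · intro h σ
    apply tcoord_ext b
    intro f
    rw [tcoord_perm, h]

/-- The index regrouping. -/
def splitE (d : ℕ) (hd : 2 ≤ d) : Fin d ≃ Fin (d - 2) ⊕ Fin 2 :=
  (finCongr (by omega : d = d - 2 + 2)).trans finSumFinEquiv.symm

theorem splitEquiv_tprod (d : ℕ) (hd : 2 ≤ d) (x : Fin d → V) :
    splitEquiv k V d hd (PiTensorProduct.tprod k x) =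
      (PiTensorProduct.tprod k fun i => x ((splitE d hd).symm (Sum.inl i))) ⊗ₜ[k]
      (PiTensorProduct.tprod k fun i => x ((splitE d hd).symm (Sum.inr i))) := by
  rw [splitEquiv, LinearEquiv.trans_apply, PiTensorProduct.reindex_tprod]
  exact PiTensorProduct.tmulEquiv_symm_apply k V _

/-- concatenation of index functions -/
def comb {d : ℕ} (hd : 2 ≤ d) (g : Fin (d - 2) → Fin n) (h : Fin 2 → Fin n) : Fin d → Fin n :=
  Sum.elim g h ∘ splitE d hd

/-- contraction of the second tensor factor -/
noncomputable def contr2 (M : Type*) [AddCommGroup M] [Module k M] (h : Fin 2 → Fin n) :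
    (M ⊗[k] (⨂[k] (_ : Fin 2), V)) →ₗ[k] M :=
  (TensorProduct.rid k M).toLinearMap ∘ₗ LinearMap.lTensor M (tcoord b h)

theorem contr2_tmul (M : Type*) [AddCommGroup M] [Module k M] (h : Fin 2 → Fin n)
    (m : M) (u : ⨂[k] (_ : Fin 2), V) :
    contr2 b M h (m ⊗ₜ u) = tcoord b h u • m := by
  simp [contr2]

theorem contr2_sum (M : Type*) [AddCommGroup M] [Module k M]
    (z : M ⊗[k] (⨂[k] (_ : Fin 2), V)) :
    z = ∑ h : Fin 2 → Fin n,
      contr2 b M h z ⊗ₜ[k] PiTensorProduct.tprod k (fun i => b (h i)) := by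
  induction z with
  | zero => simp
  | add x y hx hy =>
    simp only [map_add, TensorProduct.add_tmul, Finset.sum_add_distrib, ← hx, ← hy]
  | tmul m u =>
    simp only [contr2_tmul, TensorProduct.smul_tmul, ← TensorProduct.tmul_sum]
    congr 1
    conv_lhs => rw [← (Basis.piTensorProduct (fun _ : Fin 2 => b)).sum_repr u]
    simp [tcoord]

/-- contraction of the last two tensor factors -/
noncomputable def contr {d : ℕ} (hd : 2 ≤ d) (h : Fin 2 → Fin n) :
    (⨂[k] (_ : Fin d), V) →ₗ[k] (⨂[k] (_ : Fin (d - 2)), V) :=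
  contr2 b _ h ∘ₗ (splitEquiv k V d hd).toLinearMap

theorem tcoord_contr {d : ℕ} (hd : 2 ≤ d) (g : Fin (d - 2) → Fin n) (h : Fin 2 → Fin n)
    (t : ⨂[k] (_ : Fin d), V) :
    tcoord b g (contr b hd h t) = tcoord b (comb hd g h) t := by
  have : (tcoord b g) ∘ₗ (contr b hd h) = tcoord b (comb hd g h) := by
    apply PiTensorProduct.ext
    ext x
    simp only [LinearMap.compMultilinearMap_apply, LinearMap.comp_apply, contr,
      LinearEquiv.coe_coe, splitEquiv_tprod, contr2_tmul, map_smul, tcoord_tprod, smul_eq_mul]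
    rw [← Equiv.prod_comp (splitE d hd).symm, Fintype.prod_sum_type, mul_comm]
    simp [comb]
  exact LinearMap.congr_fun this t

theorem comb_perm {d : ℕ} (hd : 2 ≤ d) (g : Fin (d - 2) → Fin n) (h : Fin 2 → Fin n)
    (σ : Equiv.Perm (Fin (d - 2))) (τ : Equiv.Perm (Fin 2)) :
    comb hd (g ∘ σ) (h ∘ τ) =
      comb hd g h ∘ (((splitE d hd).trans (Equiv.sumCongr σ τ)).trans (splitE d hd).symm) := by
  funext i
  simp only [comb, Function.comp_apply, Equiv.trans_apply, Equiv.apply_symm_apply]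
  rcases splitE d hd i with a | a <;> simp

theorem contr_mem {d : ℕ} (hd : 2 ≤ d) (h : Fin 2 → Fin n)
    {t : ⨂[k] (_ : Fin d), V} (ht : t ∈ symTensors k V d) :
    contr b hd h t ∈ symTensors k V (d - 2) := by
  rw [mem_sym_iff b] at ht ⊢
  intro σ f
  rw [tcoord_contr, tcoord_contr]
  have := comb_perm hd f h σ 1
  rw [Equiv.Perm.coe_one, Function.comp_id] at this
  rw [this, ht]

theorem contr_swap {d : ℕ} (hd : 2 ≤ d) (h : Fin 2 → Fin n) (τ : Equiv.Perm (Fin 2))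
    {t : ⨂[k] (_ : Fin d), V} (ht : t ∈ symTensors k V d) :
    contr b hd (h ∘ τ) t = contr b hd h t := by
  apply tcoord_ext b
  intro f
  rw [mem_sym_iff b] at ht
  rw [tcoord_contr, tcoord_contr]
  have := comb_perm hd f h 1 τ
  rw [Equiv.Perm.coe_one, Function.comp_id] at this
  rw [this, ht]

/-- contraction on symmetric tensors -/
noncomputable def contrS {d : ℕ} (hd : 2 ≤ d) (h : Fin 2 → Fin n) :
    symTensors k V d →ₗ[k] symTensors k V (d - 2) :=
  (contr b hd h).restrict (fun _ ht => contr_mem b hd h ht)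

theorem swap_vec {α : Type*} (x y : α) : ![x, y] ∘ (Equiv.swap (0 : Fin 2) 1) = ![y, x] := by
  funext i
  fin_cases i <;> simp

/-- The diagonal tensor `b i ⊗ b i` -/
noncomputable def diagT (i : Fin n) : symTensors k V 2 :=
  ⟨PiTensorProduct.tprod k ![b i, b i], by
    simp only [symTensors, Submodule.mem_iInf, LinearMap.mem_ker, LinearMap.sub_apply,
      LinearMap.id_apply, sub_eq_zero, permTensor, LinearEquiv.coe_coe,
      PiTensorProduct.reindex_tprod]
    intro σ
    congr 1
    funext j
    generalize σ.symm j = l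
    fin_cases l <;> fin_cases j <;> rfl⟩

/-- The tensor `b i ⊗ b j + b j ⊗ b i` -/
noncomputable def offT (i j : Fin n) : symTensors k V 2 :=
  ⟨PiTensorProduct.tprod k ![b i, b j] + PiTensorProduct.tprod k ![b j, b i], by
    rw [mem_sym]
    intro σ
    simp only [permTensor, LinearEquiv.coe_coe, map_add, PiTensorProduct.reindex_tprod]
    have h2 : σ = 1 ∨ σ = Equiv.swap 0 1 := by revert σ; decide
    rcases h2 with rfl | rfl
    · rfl
    · have e (x y : V) : (fun i => ![x, y] ((Equiv.swap (0 : Fin 2) 1).symm i)) = ![y, x] :=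
        swap_vec x y
      rw [e, e, add_comm]⟩

theorem offT_mem (i j : Fin n) : offT b i j ∈ symmetrizedSub k V :=
  Submodule.subset_span ⟨b i, b j, rfl⟩

/-- comultiplication -/
noncomputable def comul {d : ℕ} (hd : 2 ≤ d) :
    symTensors k V d →ₗ[k] (symTensors k V (d - 2) ⊗[k] symTensors k V 2) :=
  ∑ i : Fin n, ((TensorProduct.mk k _ _).flip (diagT b i) ∘ₗ contrS b hd ![i, i]) +
  ∑ i : Fin n, ∑ j : Fin n, if i < j then
    ((TensorProduct.mk k _ _).flip (offT b i j) ∘ₗ contrS b hd ![i, j]) else 0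

theorem comul_apply {d : ℕ} (hd : 2 ≤ d) (t : symTensors k V d) :
    comul b hd t = ∑ i : Fin n, contrS b hd ![i, i] t ⊗ₜ[k] diagT b i +
      ∑ i : Fin n, ∑ j : Fin n,
        if i < j then contrS b hd ![i, j] t ⊗ₜ[k] offT b i j else 0 := by
  simp only [comul, LinearMap.add_apply, LinearMap.sum_apply]
  congr 1
  refine Finset.sum_congr rfl fun i _ => Finset.sum_congr rfl fun j _ => ?_
  split_ifs <;> rfl

theorem sum_split {M : Type*} [AddCommMonoid M] (F : Fin n → Fin n → M) :
    ∑ i, ∑ j, F i j = ∑ i, F i i + ∑ i, ∑ j, if i < j then F i j + F j i else 0 := by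
  have h1 : ∀ i j, F i j = (if i = j then F i j else 0) +
      ((if i < j then F i j else 0) + (if j < i then F i j else 0)) := by
    intro i j
    rcases lt_trichotomy i j with h | h | h
    · simp [h, h.ne, h.not_gt]
    · simp [h]
    · simp [h, h.ne', h.not_gt]
  have h2 : ∀ i j, (if i < j then F i j + F j i else 0) =
      (if i < j then F i j else 0) + (if i < j then F j i else 0) := by
    intro i j; split_ifs <;> simp
  calc ∑ i, ∑ j, F i j = ∑ i, ∑ j, ((if i = j then F i j else 0) +
      ((if i < j then F i j else 0) + (if j < i then F i j else 0))) :=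
        Finset.sum_congr rfl fun i _ => Finset.sum_congr rfl fun j _ => h1 i j
    _ = _ := by
      simp only [h2, Finset.sum_add_distrib]
      congr 1
      · simp
      · congr 1
        exact Finset.sum_comm

theorem comul_spec {d : ℕ} (hd : 2 ≤ d) (t : symTensors k V d) :
    (TensorProduct.map (symTensors k V (d - 2)).subtype (symTensors k V 2).subtype)
      (comul b hd t) = splitEquiv k V d hd (t : ⨂[k] (_ : Fin d), V) := by
  rw [contr2_sum b _ (splitEquiv k V d hd (t : ⨂[k] (_ : Fin d), V))]
  rw [← Equiv.sum_comp (finTwoArrowEquiv (Fin n)).symm, Fintype.sum_prod_type, sum_split,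
    comul_apply]
  have hv (i j : Fin n) : (fun l => b (![i, j] l)) = ![b i, b j] := by
    funext l; fin_cases l <;> rfl
  simp only [map_add, map_sum]
  refine congrArg₂ (· + ·) ?_ ?_
  · refine Finset.sum_congr rfl fun i _ => ?_
    simp only [finTwoArrowEquiv_symm_apply, hv, TensorProduct.map_tmul]
    rfl
  · refine Finset.sum_congr rfl fun i _ => Finset.sum_congr rfl fun j _ => ?_
    split_ifs
    · simp only [finTwoArrowEquiv_symm_apply, hv, TensorProduct.map_tmul]
      have : contr b hd ![j, i] (t : ⨂[k] (_ : Fin d), V) = contr b hd ![i, j] t := by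
        rw [← swap_vec, contr_swap b hd _ _ t.2]
      change contr b hd ![i, j] (t : ⨂[k] (_ : Fin d), V) ⊗ₜ[k] _ =
        contr b hd ![i, j] (t : ⨂[k] (_ : Fin d), V) ⊗ₜ[k] _ +
        contr b hd ![j, i] (t : ⨂[k] (_ : Fin d), V) ⊗ₜ[k] _
      rw [this, ← TensorProduct.tmul_add]
      rfl
    · simp

/-- the map `g` -/
noncomputable def gmap {d : ℕ} (hd : 2 ≤ d) :
    symTensors k V d →ₗ[k] ((↥(symTensors k V (d - 2))) ⊗[k]
      ((↥(symTensors k V 2)) ⧸ symmetrizedSub k V)) :=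
  (LinearMap.lTensor (↥(symTensors k V (d - 2))) (symmetrizedSub k V).mkQ) ∘ₗ comul b hd

theorem gmap_apply {d : ℕ} (hd : 2 ≤ d) (t : symTensors k V d) :
    gmap b hd t = ∑ i : Fin n, contrS b hd ![i, i] t ⊗ₜ[k]
      (symmetrizedSub k V).mkQ (diagT b i) := by
  rw [gmap, LinearMap.comp_apply, comul_apply]
  simp only [map_add, map_sum, LinearMap.lTensor_tmul]
  refine (congrArg _ ?_).trans (add_zero _)
  refine Finset.sum_eq_zero fun i _ => Finset.sum_eq_zero fun j _ => ?_
  split_ifs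
  · rw [LinearMap.lTensor_tmul, Submodule.mkQ_apply,
      (Submodule.Quotient.mk_eq_zero _).2 (offT_mem b i j), TensorProduct.tmul_zero]
  · simp

variable [CharP k 2]

/-- Diagonal coordinate on the quotient -/
noncomputable def qcoord (i : Fin n) : ((↥(symTensors k V 2)) ⧸ symmetrizedSub k V) →ₗ[k] k :=
  (symmetrizedSub k V).liftQ (tcoord b ![i, i] ∘ₗ (symTensors k V 2).subtype) (by
    rintro ⟨u, hu⟩ h
    have h' : u ∈ Submodule.span k {u : ⨂[k] (_ : Fin 2), V | ∃ x y : V,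
      u = PiTensorProduct.tprod k ![x, y] + PiTensorProduct.tprod k ![y, x]} := h
    have : Submodule.span k {u : ⨂[k] (_ : Fin 2), V | ∃ x y : V,
      u = PiTensorProduct.tprod k ![x, y] + PiTensorProduct.tprod k ![y, x]} ≤
        LinearMap.ker (tcoord b ![i, i]) := by
      rw [Submodule.span_le]
      rintro _ ⟨x, y, rfl⟩
      simp only [SetLike.mem_coe, LinearMap.mem_ker, map_add, tcoord_tprod, Fin.prod_univ_two]
      simp only [Matrix.cons_val_zero, Matrix.cons_val_one]
      rw [mul_comm, CharTwo.add_self_eq_zero]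
    exact this h')

theorem gmap_eq_zero_iff {d : ℕ} (hd : 2 ≤ d) (t : symTensors k V d) :
    gmap b hd t = 0 ↔ ∀ i, contrS b hd ![i, i] t = 0 := by
  constructor
  · intro h i
    have h' := congrArg ((TensorProduct.rid k _).toLinearMap ∘ₗ
      LinearMap.lTensor (↥(symTensors k V (d - 2))) (qcoord b i)) h
    rw [gmap_apply] at h'
    have hq (j : Fin n) : qcoord b i ((symmetrizedSub k V).mkQ (diagT b j)) =
        if j = i then 1 else 0 := by
      change tcoord b ![i, i] (PiTensorProduct.tprod k ![b j, b j]) = _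
      rw [tcoord_tprod]
      simp [Finsupp.single_apply]
    simp only [map_sum, map_zero, LinearMap.comp_apply, LinearMap.lTensor_tmul, hq,
      LinearEquiv.coe_coe, TensorProduct.rid_tmul] at h'
    simpa using h'
  · intro h
    rw [gmap_apply]
    simp [h]

theorem exists_perm {d : ℕ} {p q a c : Fin d} (hpq : p ≠ q) (hac : a ≠ c) :
    ∃ σ : Equiv.Perm (Fin d), σ p = a ∧ σ q = c := by
  refine ⟨Equiv.swap (Equiv.swap p a q) c * Equiv.swap p a, ?_, ?_⟩
  · rw [Equiv.Perm.mul_apply, Equiv.swap_apply_left, Equiv.swap_apply_of_ne_of_ne _ hac]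
    intro h
    have : Equiv.swap p a p = Equiv.swap p a q := by rw [Equiv.swap_apply_left]; exact h
    exact hpq ((Equiv.swap p a).injective this)
  · rw [Equiv.Perm.mul_apply, Equiv.swap_apply_left]

theorem gmap_eq_zero_iff' {d : ℕ} (hd : 2 ≤ d) (t : symTensors k V d) :
    gmap b hd t = 0 ↔ ∀ f : Fin d → Fin n, ¬ Function.Injective f →
      tcoord b f (t : ⨂[k] (_ : Fin d), V) = 0 := by
  rw [gmap_eq_zero_iff]
  constructor
  · intro h f hf
    simp only [Function.Injective, not_forall] at hf
    obtain ⟨a, c, hfac, hac⟩ := hf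
    have hne : (splitE d hd).symm (Sum.inr 0) ≠ (splitE d hd).symm (Sum.inr 1) := by simp
    obtain ⟨σ, h0, h1⟩ := exists_perm hne hac
    rw [← (mem_sym_iff b _).1 t.2 σ]
    have : f ∘ σ = comb hd (fun l => f (σ ((splitE d hd).symm (Sum.inl l)))) ![f a, f a] := by
      funext l
      obtain ⟨m, rfl⟩ := (splitE d hd).symm.surjective l
      rcases m with m | m
      · simp [comb]
      · fin_cases m
        · simp [comb, h0]
        · simp [comb, h1, hfac]
    rw [this, ← tcoord_contr]
    have h2 : contr b hd ![f a, f a] (t : ⨂[k] (_ : Fin d), V) = 0 :=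
      congrArg Subtype.val (h (f a))
    rw [h2, map_zero]
  · intro h i
    apply Subtype.ext
    apply tcoord_ext b
    intro g
    change tcoord b g (contr b hd ![i, i] (t : ⨂[k] (_ : Fin d), V)) = tcoord b g 0
    rw [tcoord_contr, map_zero]
    apply h
    intro hinj
    have : (splitE d hd).symm (Sum.inr 0) = (splitE d hd).symm (Sum.inr 1) := by
      apply hinj
      simp [comb]
    simp at this

theorem eq_of_strictMono {d : ℕ} {s t : ⨂[k] (_ : Fin d), V}
    (hs : s ∈ symTensors k V d) (ht : t ∈ symTensors k V d)
    (hs0 : ∀ f : Fin d → Fin n, ¬ Function.Injective f → tcoord b f s = 0)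
    (ht0 : ∀ f : Fin d → Fin n, ¬ Function.Injective f → tcoord b f t = 0)
    (h : ∀ f : Fin d ↪o Fin n, tcoord b f s = tcoord b f t) : s = t := by
  apply tcoord_ext b
  intro f
  by_cases hf : Function.Injective f
  · rw [← (mem_sym_iff b _).1 hs (Tuple.sort f), ← (mem_sym_iff b _).1 ht (Tuple.sort f)]
    exact h (OrderEmbedding.ofStrictMono _ ((Tuple.monotone_sort f).strictMono_of_injective
      (hf.comp (Tuple.sort f).injective)))
  · rw [hs0 f hf, ht0 f hf]

/-- full symmetrization -/
noncomputable def symz {d : ℕ} (x : Fin d → V) : ⨂[k] (_ : Fin d), V :=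
  ∑ σ : Equiv.Perm (Fin d), PiTensorProduct.tprod k (fun i => x (σ i))

theorem symz_mem {d : ℕ} (x : Fin d → V) : symz (k := k) x ∈ symTensors k V d := by
  rw [mem_sym]
  intro τ
  simp only [permTensor, LinearEquiv.coe_coe, symz, map_sum, PiTensorProduct.reindex_tprod]
  exact Fintype.sum_equiv (Equiv.mulRight τ⁻¹) _ _ (fun σ => rfl)

theorem symz_noninj {d : ℕ} (x : Fin d → V) (f : Fin d → Fin n)
    (hf : ¬ Function.Injective f) : tcoord b f (symz x) = 0 := by
  simp only [Function.Injective, not_forall] at hf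
  obtain ⟨a, c, hfac, hac⟩ := hf
  have hdet := Matrix.det_zero_of_column_eq (M := Matrix.of fun i j => b.repr (x i) (f j)) hac
    (by intro i; simp [hfac])
  rw [Matrix.det_apply] at hdet
  rw [symz, map_sum, ← hdet]
  refine Finset.sum_congr rfl fun σ _ => ?_
  rw [tcoord_tprod]
  rcases Int.units_eq_one_or (Equiv.Perm.sign σ) with h | h <;>
    simp [h, CharTwo.neg_eq]

theorem symz_coord {d : ℕ} (f0 f : Fin d ↪o Fin n) :
    tcoord b f (symz (fun i => b (f0 i))) = if f0 = f then 1 else 0 := by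
  simp only [symz, map_sum, tcoord_tprod, Basis.repr_self, Finsupp.single_apply,
    Fintype.prod_ite_zero, Finset.prod_const_one]
  rw [Finset.sum_eq_single 1]
  · congr 1
    simp [DFunLike.ext_iff]
  · intro σ _ hσ
    rw [if_neg]
    intro h
    apply hσ
    have hm : StrictMono σ := by
      intro i j hij
      rw [← f0.lt_iff_lt, h, h]
      exact f.lt_iff_lt.2 hij
    ext i
    have h1 := DFunLike.congr_fun (Subsingleton.elim
      (hm.orderIsoOfSurjective _ σ.surjective) (OrderIso.refl _)) i
    exact congrArg Fin.val h1
  · simp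

theorem mem_antisym_iff {d : ℕ} (t : symTensors k V d) :
    t ∈ antisymImage k V d ↔ ∀ f : Fin d → Fin n, ¬ Function.Injective f →
      tcoord b f (t : ⨂[k] (_ : Fin d), V) = 0 := by
  constructor
  · intro h f hf
    have h' : (t : ⨂[k] (_ : Fin d), V) ∈
      Submodule.span k {u : ⨂[k] (_ : Fin d), V | ∃ x : Fin d → V,
      u = ∑ σ : Equiv.Perm (Fin d), PiTensorProduct.tprod k (fun i => x (σ i))} := h
    have : Submodule.span k {u : ⨂[k] (_ : Fin d), V | ∃ x : Fin d → V,
      u = ∑ σ : Equiv.Perm (Fin d), PiTensorProduct.tprod k (fun i => x (σ i))} ≤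
        LinearMap.ker (tcoord b f) := by
      rw [Submodule.span_le]
      rintro _ ⟨x, rfl⟩
      exact symz_noninj b x f hf
    exact this h'
  · intro h
    have key : (t : ⨂[k] (_ : Fin d), V) = ∑ f0 : Fin d ↪o Fin n,
        tcoord b f0 (t : ⨂[k] (_ : Fin d), V) • symz (fun i => b (f0 i)) := by
      apply eq_of_strictMono b t.2 _ h
      · intro f hf
        simp [symz_noninj b _ f hf]
      · intro f
        simp [symz_coord]
      · exact Submodule.sum_mem _ fun f0 _ => Submodule.smul_mem _ _ (symz_mem _)
    change (t : ⨂[k] (_ : Fin d), V) ∈ Submodule.span k _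
    rw [key]
    exact Submodule.sum_mem _ fun f0 _ => Submodule.smul_mem _ _
      (Submodule.subset_span ⟨fun i => b (f0 i), rfl⟩)

theorem finrank_antisym (b : Basis (Fin n) k V) (d : ℕ) :
    finrank k (antisymImage k V d) = Nat.choose n d := by
  let L : antisymImage k V d →ₗ[k] ((Fin d ↪o Fin n) → k) :=
    LinearMap.pi fun f => tcoord b f ∘ₗ (symTensors k V d).subtype ∘ₗ
      (antisymImage k V d).subtype
  have hL : Function.Bijective L := by
    constructor
    · intro s t hst
      apply Subtype.ext
      apply Subtype.ext
      exact eq_of_strictMono b s.1.2 t.1.2 ((mem_antisym_iff b _).1 s.2)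
        ((mem_antisym_iff b _).1 t.2) (fun f => congrFun hst f)
    · intro a
      have hm : ∑ f0 : Fin d ↪o Fin n, a f0 • symz (fun i => b (f0 i)) ∈ symTensors k V d :=
        Submodule.sum_mem _ fun f0 _ => Submodule.smul_mem _ _ (symz_mem _)
      refine ⟨⟨⟨_, hm⟩, ?_⟩, ?_⟩
      · change _ ∈ Submodule.span k _
        exact Submodule.sum_mem _ fun f0 _ => Submodule.smul_mem _ _
          (Submodule.subset_span ⟨fun i => b (f0 i), rfl⟩)
      · funext f
        change tcoord b f (∑ f0 : Fin d ↪o Fin n, a f0 • symz (fun i => b (f0 i))) = a f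
        simp [symz_coord]
  rw [(LinearEquiv.ofBijective L hL).finrank_eq, finrank_fintype_fun_eq_card,
    ← Nat.card_eq_fintype_card, Nat.card_congr Set.powersetCard.ofFinEmbEquiv,
    Set.powersetCard.card]
  simp

end Helpers

/-- Let `k` be a field of characteristic 2, `V` finite dimensional, `d ≥ 2`.
Let `g : Γ^d(V) → Γ^{d-2}(V) ⊗ V^{(1)}` be induced by the comultiplication
`Γ^d(V) → Γ^{d-2}(V) ⊗ Γ²(V)` (restriction of the deconcatenation of tensors) followed by
the Verschiebung `Γ²(V) → V^{(1)} = Γ²(V)/Λ²(V)`.  Then the kernel of `g` is exactly the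
image of the canonical inclusion `Λ^d(V) ↪ Γ^d(V)`, and equivalently the dimension of the
image of `g` is `dim Γ^d(V) − dim Λ^d(V)`. -/
theorem ker_comult_verschiebung [CharP k 2] [Module.Finite k V] (d : ℕ) (hd : 2 ≤ d) :
    ∃ (Δ : (symTensors k V d) →ₗ[k] ((symTensors k V (d - 2)) ⊗[k] (symTensors k V 2)))
      (g : (symTensors k V d) →ₗ[k]
        ((↥(symTensors k V (d - 2))) ⊗[k] ((↥(symTensors k V 2)) ⧸ symmetrizedSub k V))),
      (∀ t : symTensors k V d,
        (TensorProduct.map (symTensors k V (d - 2)).subtype (symTensors k V 2).subtype)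
            (Δ t) = splitEquiv k V d hd (t : ⨂[k] (_ : Fin d), V)) ∧
      (∀ t : symTensors k V d,
        g t = (LinearMap.lTensor (↥(symTensors k V (d - 2))) (symmetrizedSub k V).mkQ)
          (Δ t)) ∧
      LinearMap.ker g = antisymImage k V d ∧
      Module.finrank k (LinearMap.range g) =
        Module.finrank k (symTensors k V d) - Module.finrank k (⋀[k]^d V) := by
  let b := Module.finBasis k V
  have hk : LinearMap.ker (gmap b hd) = antisymImage k V d := by
    ext t
    rw [LinearMap.mem_ker, gmap_eq_zero_iff', mem_antisym_iff b]
  refine ⟨comul b hd, gmap b hd, comul_spec b hd, fun t => rfl, hk, ?_⟩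
  have : Module.Finite k (⨂[k] (_ : Fin d), V) :=
    Module.Finite.of_basis (Basis.piTensorProduct (fun _ : Fin d => b))
  have h := LinearMap.finrank_range_add_finrank_ker (gmap b hd)
  rw [hk, finrank_antisym b] at h
  rw [exteriorPower.finrank_eq]
  omega
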